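/- arXiv:0907.0845 — 2 statements merged into one kernel-verified Lean document; each statement's English description precedes it below -/
import Mathlib

section
/- Let G = (V,E) be an oriented graph and ℓ a positive integer. Then (−1)^{|V| − c(G)} · τ̄_G(−ℓ) equals the number of pairs (t,σ) where t is a Z_ℓ-tension on G (not necessarily nowhere-zero) and σ is an acyclic reorientation of the deletion G_∖supp(t). -/
namespace ModularFlows

attribute [local instance] Classical.propDecidable

variable {V E : Type}

/-- A directed (simple) cycle, given by its cyclically ordered edges
`c 0, c 1, …, c n`: consecutive edges are head-to-tail compatible (also from
`c n` back to `c 0`) and the start vertices are pairwise distinct. -/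
def IsDirCycle (src tgt : E → V) (n : ℕ) (c : Fin (n + 1) → E) : Prop :=
  Function.Injective (fun i => src (c i)) ∧ ∀ i, tgt (c i) = src (c (i + 1))

/-- An oriented graph is totally cyclic if every edge lies on a directed cycle. -/
def TotallyCyclic (src tgt : E → V) : Prop :=
  ∀ e : E, ∃ (n : ℕ) (c : Fin (n + 1) → E), IsDirCycle src tgt n c ∧ e ∈ Set.range c

/-- An oriented graph is acyclic if it contains no directed cycle. -/
def Acyclic (src tgt : E → V) : Prop :=
  ∀ (n : ℕ) (c : Fin (n + 1) → E), ¬ IsDirCycle src tgt n c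

/-- Source map of the reorientation of the graph along `σ`. -/
noncomputable def rsrc (src tgt : E → V) (σ : Set E) (e : E) : V :=
  if e ∈ σ then tgt e else src e

/-- Target map of the reorientation of the graph along `σ`. -/
noncomputable def rtgt (src tgt : E → V) (σ : Set E) (e : E) : V :=
  if e ∈ σ then src e else tgt e

/-- A `ZMod k`-flow: conservation of flow at every vertex. -/
def IsFlow [Fintype E] (src tgt : E → V) (k : ℕ) (f : E → ZMod k) : Prop :=
  ∀ v : V, (∑ e : E, if tgt e = v then f e else 0) = ∑ e : E, if src e = v then f e else 0

/-- Start vertex of an edge traversed forwards (`true`) or backwards (`false`). -/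
def uSrc (src tgt : E → V) (p : E × Bool) : V := if p.2 then src p.1 else tgt p.1

/-- End vertex of an edge traversed forwards (`true`) or backwards (`false`). -/
def uTgt (src tgt : E → V) (p : E × Bool) : V := if p.2 then tgt p.1 else src p.1

/-- A cycle of the underlying undirected graph, with a chosen traversal
direction: a cyclic sequence of edges, each traversed forwards or backwards,
consecutive ones compatible, visiting pairwise distinct vertices. -/
def IsUCycle (src tgt : E → V) (n : ℕ) (c : Fin (n + 1) → E × Bool) : Prop :=
  Function.Injective (fun i => uSrc src tgt (c i)) ∧
    ∀ i, uTgt src tgt (c i) = uSrc src tgt (c (i + 1))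

/-- A `ZMod l`-tension: the signed sum over every cycle of the underlying
undirected graph (forward edges positively, backward edges negatively) vanishes. -/
def IsTension (src tgt : E → V) (l : ℕ) (t : E → ZMod l) : Prop :=
  ∀ (n : ℕ) (c : Fin (n + 1) → E × Bool), IsUCycle src tgt n c →
    (∑ i : Fin (n + 1), if (c i).2 then t (c i).1 else - t (c i).1) = 0

/-- Adjacency via an edge of `S` (its equivalence closure gives the components
of the spanning subgraph `(V, S)`). -/
def linkRel (src tgt : E → V) (S : Set E) (u v : V) : Prop :=
  ∃ e ∈ S, src e = u ∧ tgt e = v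

/-- Number of (weakly) connected components of the spanning subgraph `(V, S)`. -/
noncomputable def ncompSub (src tgt : E → V) (S : Set E) : ℕ :=
  Nat.card (Quot (linkRel src tgt S))

/-- Number of (weakly) connected components. -/
noncomputable def ncomp (src tgt : E → V) : ℕ :=
  ncompSub src tgt Set.univ

/-- The cyclotomic number `ξ(G) = |E| - |V| + c(G)`. -/
noncomputable def xi [Fintype V] [Fintype E] (src tgt : E → V) : ℤ :=
  (Fintype.card E : ℤ) - (Fintype.card V : ℤ) + (ncomp src tgt : ℤ)

/-- Source map of the contraction `G/S`: vertices are identified along edges of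
`S`, and the edges of `S` are removed. -/
def csrc (src tgt : E → V) (S : Set E) (e : {e : E // e ∉ S}) :
    Quot (linkRel src tgt S) :=
  Quot.mk _ (src e.1)

/-- Target map of the contraction `G/S`. -/
def ctgt (src tgt : E → V) (S : Set E) (e : {e : E // e ∉ S}) :
    Quot (linkRel src tgt S) :=
  Quot.mk _ (tgt e.1)

/-- Source (or target) map of the deletion `G∖S`. -/
def dsrc (src : E → V) (S : Set E) (e : {e : E // e ∉ S}) : V := src e.1

/-- Source (or target) map of the restriction `G[S]`. -/
def ressrc (src : E → V) (S : Set E) (e : {e : E // e ∈ S}) : V := src e.1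

/-- `σ` is a totally cyclic reorientation of the contraction `G/S`. -/
def TCReorContr (src tgt : E → V) (S σ : Set E) : Prop :=
  TotallyCyclic (rsrc (csrc src tgt S) (ctgt src tgt S) {e | e.1 ∈ σ})
                (rtgt (csrc src tgt S) (ctgt src tgt S) {e | e.1 ∈ σ})

/-- `σ` is a totally cyclic reorientation of the deletion `G∖S`. -/
def TCReorDel (src tgt : E → V) (S σ : Set E) : Prop :=
  TotallyCyclic (rsrc (dsrc src S) (dsrc tgt S) {e | e.1 ∈ σ})
                (rtgt (dsrc src S) (dsrc tgt S) {e | e.1 ∈ σ})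

/-- `σ` is an acyclic reorientation of the deletion `G∖S`. -/
def AcyclicReorDel (src tgt : E → V) (S σ : Set E) : Prop :=
  Acyclic (rsrc (dsrc src S) (dsrc tgt S) {e | e.1 ∈ σ})
          (rtgt (dsrc src S) (dsrc tgt S) {e | e.1 ∈ σ})

/-- Entry of the incidence matrix `A_G` at vertex `v` and edge `e`. -/
noncomputable def inc (src tgt : E → V) (v : V) (e : E) : ℤ :=
  (if tgt e = v then 1 else 0) - (if src e = v then 1 else 0)

/-- The number of nowhere-zero `ZMod k`-flows. -/
noncomputable def nzFlowCount [Fintype E] (src tgt : E → V) (k : ℕ) : ℕ :=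
  Nat.card {f : E → ZMod k // IsFlow src tgt k f ∧ ∀ e, f e ≠ 0}

/-- The number of nowhere-zero `ZMod l`-tensions. -/
noncomputable def nzTensionCount (src tgt : E → V) (l : ℕ) : ℕ :=
  Nat.card {t : E → ZMod l // IsTension src tgt l t ∧ ∀ e, t e ≠ 0}

/-- The rank `r(S) = |V| - c(V,S)` of an edge set `S`. -/
noncomputable def rk [Fintype V] (src tgt : E → V) (S : Set E) : ℕ :=
  Fintype.card V - ncompSub src tgt S

/-- The Tutte polynomial `t_G(x,y) = Σ_{S ⊆ E} (x-1)^{r(E)-r(S)} (y-1)^{|S|-r(S)}`. -/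
noncomputable def tutte [Fintype V] [Fintype E] (src tgt : E → V) (x y : ℚ) : ℚ :=
  ∑ S : Finset E,
    (x - 1) ^ (rk src tgt Set.univ - rk src tgt ↑S) * (y - 1) ^ (S.card - rk src tgt ↑S)

/-- `e` is a coloop (bridge): deleting it increases the number of components. -/
def IsColoop (src tgt : E → V) (e : E) : Prop :=
  ncompSub src tgt ({e} : Set E)ᶜ = ncomp src tgt + 1

/-- The number of pairs `(f, σ)` of a `ZMod k`-flow `f` and a totally cyclic
reorientation `σ ⊆ E ∖ supp f` of the contraction `G/supp f`. -/
noncomputable def phiR [Fintype E] (src tgt : E → V) (k : ℕ) : ℕ :=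
  Nat.card {p : (E → ZMod k) × Set E //
    IsFlow src tgt k p.1 ∧ p.2 ⊆ {e | p.1 e = 0} ∧
    TCReorContr src tgt {e | p.1 e ≠ 0} p.2}

/-- The in-degree sequence of the reorientation of the graph along `σ`. -/
noncomputable def indegSeq [Fintype E] (src tgt : E → V) (σ : Set E) (v : V) : ℤ :=
  (Nat.card {e : E // rtgt src tgt σ e = v} : ℤ)

/-- The vector `A_G · e_σ`, where `e_σ` is the characteristic vector of `σ`. -/
noncomputable def AeVec [Fintype E] (src tgt : E → V) (σ : Set E) (v : V) : ℤ :=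
  ∑ e : E, if e ∈ σ then inc src tgt v e else 0

/-- `τ'` is obtained from `τ` by reversing a directed cycle of `_τG`. -/
def cycleReverse (src tgt : E → V) (τ τ' : Set E) : Prop :=
  ∃ (n : ℕ) (c : Fin (n + 1) → E),
    IsDirCycle (rsrc src tgt τ) (rtgt src tgt τ) n c ∧ τ' = symmDiff τ (Set.range c)


/-- A potential on the edge set `D` of the reorientation along `σ`: a height function increasing
strictly along every edge. It witnesses acyclicity. -/
def HasPotential (src tgt : E → V) (D : Set E) (σ : Set E) : Prop :=
  ∃ h : V → ℕ, ∀ e ∈ D, h (rsrc src tgt σ e) < h (rtgt src tgt σ e)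

/-- The number of reorientations of the spanning subgraph with edge set `D` that admit a
potential. -/
noncomputable def potentialCount (src tgt : E → V) (D : Finset E) : ℚ :=
  ∑ σ ∈ D.powerset, if HasPotential src tgt (D : Set E) (σ : Set E) then 1 else 0

/-- In a finite graph every infinite directed walk contains a directed cycle. -/
theorem exists_isDirCycle_of_walk [Finite V] (s t : E → V) (w : ℕ → E)
    (hw : ∀ n, t (w n) = s (w (n + 1))) :
    ∃ (n : ℕ) (c : Fin (n + 1) → E), IsDirCycle s t n c := by
  have hex : ∃ d, ∃ i, s (w (i + (d + 1))) = s (w i) := by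
    obtain ⟨i, j, hij, h⟩ := Finite.exists_ne_map_eq_of_infinite (fun n => s (w n))
    rcases Nat.lt_or_gt_of_ne hij with h' | h'
    · exact ⟨j - i - 1, i, by rw [show i + (j - i - 1 + 1) = j by omega]; exact h.symm⟩
    · exact ⟨i - j - 1, j, by rw [show j + (i - j - 1 + 1) = i by omega]; exact h⟩
  obtain ⟨i, hi⟩ := Nat.find_spec hex
  have hmin : ∀ a b, a < b → b ≤ Nat.find hex → s (w (i + a)) ≠ s (w (i + b)) := by
    intro a b hab hb h
    refine Nat.find_min hex (m := b - a - 1) (by omega) ⟨i + a, ?_⟩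
    rw [show i + a + (b - a - 1 + 1) = i + b by omega]
    exact h.symm
  refine ⟨Nat.find hex, fun k => w (i + k), ?_, ?_⟩
  · intro a b hab
    by_contra hne
    rcases Nat.lt_or_gt_of_ne (fun h => hne (Fin.ext h)) with h' | h'
    · exact hmin a b h' (by omega) hab
    · exact hmin b a h' (by omega) hab.symm
  · intro k
    show t (w (i + k)) = s (w (i + (k + 1 : Fin _)))
    rw [hw]
    induction k using Fin.lastCases with
    | last => simpa [add_assoc] using hi
    | cast k => rw [Fin.coeSucc_eq_succ]; simp [add_assoc]

theorem acyclic_iff_exists_potential [Finite V] (s t : E → V) :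
    Acyclic s t ↔ ∃ h : V → ℕ, ∀ e, h (s e) < h (t e) := by
  constructor
  · intro hac
    have hwf : WellFounded (fun u v => ∃ e, t e = u ∧ s e = v) := by
      rw [wellFounded_iff_isEmpty_descending_chain]
      refine ⟨fun ⟨f, hf⟩ => ?_⟩
      choose w hw1 hw2 using hf
      obtain ⟨n, c, hc⟩ := exists_isDirCycle_of_walk s t w (fun n => by rw [hw1, hw2])
      exact hac n c hc
    have : Fintype V := Fintype.ofFinite V
    let r : V → V → Prop := Relation.TransGen fun u v => ∃ e, s e = u ∧ t e = v
    have hirr : ∀ v, ¬ r v v := fun v hv => by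
      refine hwf.transGen.irrefl.irrefl v ?_
      have hswap := Relation.transGen_swap.2 hv
      simpa only [Function.swap, and_comm] using hswap
    refine ⟨fun v => (Finset.univ.filter fun u => r u v).card, fun e => ?_⟩
    have he : r (s e) (t e) := Relation.TransGen.single ⟨e, rfl, rfl⟩
    refine Finset.card_lt_card ((Finset.ssubset_iff_of_subset ?_).2 ⟨s e, ?_, ?_⟩)
    · intro u hu
      simp only [Finset.mem_filter, Finset.mem_univ, true_and] at hu ⊢
      exact hu.trans he
    · simpa using he
    · simpa using hirr (s e)
  · rintro ⟨h, hh⟩ n c ⟨-, hc⟩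
    have h1 : ∑ i, h (s (c i)) < ∑ i, h (t (c i)) :=
      Finset.sum_lt_sum_of_nonempty Finset.univ_nonempty fun i _ => hh (c i)
    simp only [hc] at h1
    exact h1.ne (Equiv.sum_comp (Equiv.addRight (1 : Fin (n + 1))) fun i => h (s (c i))).symm

/-- The potential difference along each edge. -/
def coboundary {l : ℕ} (src tgt : E → V) (x : V → ZMod l) (e : E) : ZMod l :=
  x (tgt e) - x (src e)

theorem signed_coboundary {l : ℕ} (src tgt : E → V) (x : V → ZMod l) (q : E × Bool) :
    (if q.2 then coboundary src tgt x q.1 else - coboundary src tgt x q.1) =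
      x (uTgt src tgt q) - x (uSrc src tgt q) := by
  rcases q with ⟨e, _ | _⟩ <;> simp [coboundary, uTgt, uSrc]

theorem isTension_coboundary {l : ℕ} (src tgt : E → V) (x : V → ZMod l) :
    IsTension src tgt l (coboundary src tgt x) := by
  rintro n c ⟨-, hc⟩
  simp only [signed_coboundary, hc, Finset.sum_sub_distrib]
  exact sub_eq_zero.2 (Equiv.sum_comp (Equiv.addRight (1 : Fin (n + 1)))
    fun i => x (uSrc src tgt (c i)))

/-- The simple graph whose edges are the links, in either direction, through `S`. -/
def linkGraph (src tgt : E → V) (S : Set E) : SimpleGraph V :=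
  SimpleGraph.fromRel (linkRel src tgt S)

theorem exists_of_linkGraph_adj {src tgt : E → V} {S : Set E} {u v : V}
    (h : (linkGraph src tgt S).Adj u v) :
    ∃ q : E × Bool, q.1 ∈ S ∧ uSrc src tgt q = u ∧ uTgt src tgt q = v := by
  rcases h with ⟨-, ⟨e, he, h1, h2⟩ | ⟨e, he, h1, h2⟩⟩
  · exact ⟨(e, true), he, by simpa [uSrc] using h1, by simpa [uTgt] using h2⟩
  · exact ⟨(e, false), he, by simpa [uSrc] using h2, by simpa [uTgt] using h1⟩

theorem linkGraph_reachable {src tgt : E → V} {S : Set E} {e : E} (he : e ∈ S) :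
    (linkGraph src tgt S).Reachable (src e) (tgt e) := by
  by_cases h : src e = tgt e
  · rw [h]
  · exact SimpleGraph.Adj.reachable ⟨h, Or.inl ⟨e, he, rfl, rfl⟩⟩

/-- A tension that is a potential difference on `S` is one along every edge whose ends are
connected through `S`. -/
theorem IsTension.eq_coboundary_of_reachable {l : ℕ} {src tgt : E → V} {t : E → ZMod l}
    (ht : IsTension src tgt l t) {S : Set E} {x : V → ZMod l}
    (hx : ∀ e ∈ S, t e = coboundary src tgt x e) {e : E}
    (he : (linkGraph src tgt S).Reachable (src e) (tgt e)) :
    t e = coboundary src tgt x e := by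
  obtain ⟨p, hp⟩ := he.symm.exists_isPath
  have hq : ∀ k : Fin p.length, ∃ q : E × Bool, q.1 ∈ S ∧
      uSrc src tgt q = p.getVert k ∧ uTgt src tgt q = p.getVert (k + 1) :=
    fun k => exists_of_linkGraph_adj (p.adj_getVert_succ k.2)
  choose q hqS hq1 hq2 using hq
  have hsrc : ∀ i, uSrc src tgt (Fin.snoc (α := fun _ => E × Bool) q (e, true) i) =
      p.getVert i := by
    intro i
    induction i using Fin.lastCases with
    | last => simp [uSrc]
    | cast k => simp [hq1]
  have hcyc : IsUCycle src tgt p.length (Fin.snoc (α := fun _ => E × Bool) q (e, true)) := by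
    refine ⟨fun i j hij => ?_, fun i => ?_⟩
    · simp only [hsrc] at hij
      exact Fin.ext (hp.getVert_injOn (by simpa using Fin.is_le i) (by simpa using Fin.is_le j) hij)
    · rw [hsrc]
      induction i using Fin.lastCases with
      | last => simp [uTgt]
      | cast k => rw [Fin.coeSucc_eq_succ]; simp [hq2]
  have hsum := ht _ _ hcyc
  have key : ∀ k, (if (q k).2 then t (q k).1 else - t (q k).1) =
      x (p.getVert (k + 1)) - x (p.getVert k) := by
    intro k
    rw [hx _ (hqS k), signed_coboundary, hq1, hq2]
  rw [Fin.sum_univ_castSucc] at hsum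
  simp only [Fin.snoc_castSucc, Fin.snoc_last, key, if_true] at hsum
  rw [Fin.sum_univ_eq_sum_range fun k => x (p.getVert (k + 1)) - x (p.getVert k),
    Finset.sum_range_sub (fun k => x (p.getVert k))] at hsum
  simp only [SimpleGraph.Walk.getVert_length, SimpleGraph.Walk.getVert_zero] at hsum
  rw [coboundary]
  linear_combination hsum

/-- Every tension is the difference of a potential. -/
theorem IsTension.exists_coboundary [Fintype E] {l : ℕ} {src tgt : E → V} {t : E → ZMod l}
    (ht : IsTension src tgt l t) : ∃ x : V → ZMod l, coboundary src tgt x = t := by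
  suffices H : ∀ S : Finset E, ∃ x : V → ZMod l, ∀ e ∈ S, t e = coboundary src tgt x e by
    obtain ⟨x, hx⟩ := H Finset.univ
    exact ⟨x, funext fun e => (hx e (Finset.mem_univ e)).symm⟩
  intro S
  induction S using Finset.induction_on with
  | empty => exact ⟨0, by simp⟩
  | insert e S _ ih =>
    obtain ⟨x, hx⟩ := ih
    by_cases he : (linkGraph src tgt (S : Set E)).Reachable (src e) (tgt e)
    · exact ⟨x, Finset.forall_mem_insert _ _ _ |>.2
        ⟨ht.eq_coboundary_of_reachable (S := (S : Set E)) hx he, hx⟩⟩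
    · refine ⟨fun v => x v + if (linkGraph src tgt (S : Set E)).Reachable v (tgt e) then
        t e - coboundary src tgt x e else 0, Finset.forall_mem_insert _ _ _ |>.2 ⟨?_, ?_⟩⟩
      · simp only [coboundary, he, SimpleGraph.Reachable.refl, if_true, if_false]
        ring
      · intro f hf
        have hf' : (linkGraph src tgt (S : Set E)).Reachable (src f) (tgt e) ↔
            (linkGraph src tgt (S : Set E)).Reachable (tgt f) (tgt e) :=
          ⟨(linkGraph_reachable (Finset.mem_coe.2 hf)).symm.trans,
            (linkGraph_reachable (Finset.mem_coe.2 hf)).trans⟩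
        rw [hx f hf]
        simp only [coboundary, hf']
        ring

/-- Each tension has `l ^ c(G)` potentials. -/
theorem sum_coboundary [Fintype V] [Fintype E] (l : ℕ) [NeZero l] (src tgt : E → V)
    (f : (E → ZMod l) → ℚ) :
    ∑ x : V → ZMod l, f (coboundary src tgt x) =
      (l : ℚ) ^ ncomp src tgt * ∑ t : {t : E → ZMod l // IsTension src tgt l t}, f t.1 := by
  choose s hs using fun t : {t : E → ZMod l // IsTension src tgt l t} => t.2.exists_coboundary
  let Q := Quot (linkRel src tgt Set.univ)
  have : Fintype Q := Fintype.ofFinite Q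
  let g : {t : E → ZMod l // IsTension src tgt l t} × (Q → ZMod l) → V → ZMod l :=
    fun p v => s p.1 v + p.2 (Quot.mk _ v)
  have hg : ∀ p, coboundary src tgt (g p) = p.1.1 := by
    intro p
    rw [← hs p.1]
    funext e
    have : (Quot.mk _ (src e) : Q) = Quot.mk _ (tgt e) := Quot.sound ⟨e, trivial, rfl, rfl⟩
    simp only [coboundary, g, this]
    ring
  have hbij : Function.Bijective g := by
    constructor
    · rintro ⟨t, y⟩ ⟨t', y'⟩ h
      obtain rfl : t = t' := Subtype.ext (by rw [← hg (t, y), ← hg (t', y'), h])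
      refine Prod.ext rfl (funext fun q => ?_)
      induction q using Quot.ind with
      | mk v => exact add_left_cancel (congrFun h v)
    · intro x
      let t : {t : E → ZMod l // IsTension src tgt l t} := ⟨_, isTension_coboundary src tgt x⟩
      refine ⟨(t, Quot.lift (fun v => x v - s t v) ?_), ?_⟩
      · rintro u v ⟨e, -, rfl, rfl⟩
        have := congrFun (hs t) e
        simp only [coboundary, t] at this ⊢
        linear_combination this
      · funext v
        simp [g]
  rw [← Equiv.sum_comp (Equiv.ofBijective g hbij), Fintype.sum_prod_type, Finset.mul_sum]
  refine Finset.sum_congr rfl fun t _ => ?_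
  simp only [Equiv.ofBijective_apply, hg, Finset.sum_const, Finset.card_univ, Fintype.card_fun,
    ZMod.card, nsmul_eq_mul, Nat.cast_pow]
  rw [ncomp, ncompSub, Nat.card_eq_fintype_card]

/-- The vertices that remain after contracting `b` into another vertex. -/
def MergedVertex (b : V) : Type := {v : V // v ≠ b}

noncomputable instance [Fintype V] (b : V) : Fintype (MergedVertex b) :=
  inferInstanceAs (Fintype {v : V // v ≠ b})

theorem card_eq_card_mergedVertex_add_one [Fintype V] (b : V) :
    Fintype.card V = Fintype.card (MergedVertex b) + 1 := by
  have h : Fintype.card (MergedVertex b) = Fintype.card {v : V // v ≠ b} :=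
    Fintype.card_congr (Equiv.refl _)
  have := Fintype.card_pos_iff.2 ⟨b⟩
  rw [h, Fintype.card_subtype_compl, Fintype.card_subtype_eq]
  omega

/-- Contraction of `b` into `a`. -/
noncomputable def mergeInto {a b : V} (hab : a ≠ b) (v : V) : MergedVertex b :=
  if h : v = b then ⟨a, hab⟩ else ⟨v, h⟩

theorem mergeInto_val {a b : V} (hab : a ≠ b) (v : MergedVertex b) :
    mergeInto hab v.1 = v :=
  dif_neg v.2

theorem apply_mergeInto {K : Type*} {a b : V} (hab : a ≠ b) {x : V → K} (hx : x a = x b) (v : V) :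
    x (mergeInto hab v).1 = x v := by
  by_cases h : v = b
  · rw [show mergeInto hab v = ⟨a, hab⟩ from dif_pos h, h, hx]
  · rw [show mergeInto hab v = ⟨v, h⟩ from dif_neg h]

theorem mergeInto_eq {a b : V} (hab : a ≠ b) : mergeInto hab a = mergeInto hab b := by
  rw [show mergeInto hab a = ⟨a, hab⟩ from dif_neg hab,
    show mergeInto hab b = ⟨a, hab⟩ from dif_pos rfl]

theorem rsrc_comp {W : Type} (π : V → W) (src tgt : E → V) (σ : Set E) (e : E) :
    rsrc (π ∘ src) (π ∘ tgt) σ e = π (rsrc src tgt σ e) := by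
  simp only [rsrc, Function.comp]; split_ifs <;> rfl

theorem rtgt_comp {W : Type} (π : V → W) (src tgt : E → V) (σ : Set E) (e : E) :
    rtgt (π ∘ src) (π ∘ tgt) σ e = π (rtgt src tgt σ e) := by
  simp only [rtgt, Function.comp]; split_ifs <;> rfl

theorem hasPotential_merge_iff (src tgt : E → V) (D σ : Set E) {a b : V} (hab : a ≠ b) :
    HasPotential (mergeInto hab ∘ src) (mergeInto hab ∘ tgt) D σ ↔
      ∃ h : V → ℕ, (∀ e ∈ D, h (rsrc src tgt σ e) < h (rtgt src tgt σ e)) ∧ h a = h b := by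
  constructor
  · rintro ⟨h, hh⟩
    refine ⟨h ∘ mergeInto hab, fun e he => ?_, by simp [mergeInto_eq hab]⟩
    have := hh e he
    rwa [rsrc_comp, rtgt_comp] at this
  · rintro ⟨h, hh, heq⟩
    refine ⟨fun v => h v.1, fun e he => ?_⟩
    dsimp only
    rw [rsrc_comp, rtgt_comp, apply_mergeInto hab heq, apply_mergeInto hab heq]
    exact hh e he

theorem hasPotential_insert_iff (src tgt : E → V) {D σ : Finset E} {e₀ : E} (he₀ : e₀ ∉ D)
    (hσ : σ ⊆ D) :
    HasPotential src tgt (insert e₀ D : Finset E) σ ↔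
      ∃ h : V → ℕ, (∀ e ∈ D, h (rsrc src tgt σ e) < h (rtgt src tgt σ e)) ∧
        h (src e₀) < h (tgt e₀) := by
  have h0 : e₀ ∉ σ := fun h => he₀ (hσ h)
  simp [HasPotential, rsrc, rtgt, h0, and_comm]

theorem hasPotential_insert_insert_iff (src tgt : E → V) {D : Finset E} (σ : Finset E) {e₀ : E}
    (he₀ : e₀ ∉ D) :
    HasPotential src tgt (insert e₀ D : Finset E) (insert e₀ σ : Finset E) ↔
      ∃ h : V → ℕ, (∀ e ∈ D, h (rsrc src tgt σ e) < h (rtgt src tgt σ e)) ∧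
        h (tgt e₀) < h (src e₀) := by
  have key : ∀ e ∈ D, (e ∈ (↑(insert e₀ σ) : Set E) ↔ e ∈ (σ : Set E)) := by
    intro e he
    have : e ≠ e₀ := fun h => he₀ (h ▸ he)
    simp [this]
  unfold HasPotential
  refine exists_congr fun h => ?_
  rw [Finset.coe_insert, Set.forall_mem_insert, and_comm]
  refine and_congr (forall₂_congr fun e he => ?_) ?_
  · rw [rsrc, rtgt, rsrc, rtgt, key e he]
  · simp [rsrc, rtgt]

/-- Two strict potentials that order `a` and `b` oppositely combine into one that is equal on
them, and conversely. -/
theorem exists_potential_eq_iff (s t : E → V) (D : Set E) {a b : V} (hab : a ≠ b) :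
    (∃ h : V → ℕ, (∀ e ∈ D, h (s e) < h (t e)) ∧ h a = h b) ↔
      (∃ h : V → ℕ, (∀ e ∈ D, h (s e) < h (t e)) ∧ h a < h b) ∧
      (∃ h : V → ℕ, (∀ e ∈ D, h (s e) < h (t e)) ∧ h b < h a) := by
  have bump : ∀ (h : V → ℕ) (c d : V), c ≠ d → (∀ e ∈ D, h (s e) < h (t e)) → h c = h d →
      ∃ h : V → ℕ, (∀ e ∈ D, h (s e) < h (t e)) ∧ h c < h d := by
    intro h c d hcd hh heq
    refine ⟨fun v => 2 * h v + if v = d then 1 else 0, fun e he => ?_, ?_⟩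
    · have := hh e he
      dsimp only
      split_ifs <;> omega
    · simp [hcd, heq]
  constructor
  · rintro ⟨h, hh, heq⟩
    exact ⟨bump h a b hab hh heq, bump h b a hab.symm hh heq.symm⟩
  · rintro ⟨⟨h₁, hh₁, hlt₁⟩, h₂, hh₂, hlt₂⟩
    obtain ⟨d₁, hd₁⟩ := Nat.exists_eq_add_of_lt hlt₁
    obtain ⟨d₂, hd₂⟩ := Nat.exists_eq_add_of_lt hlt₂
    refine ⟨fun v => (d₂ + 1) * h₁ v + (d₁ + 1) * h₂ v, fun e he => ?_, ?_⟩
    · exact add_lt_add (Nat.mul_lt_mul_of_pos_left (hh₁ e he) (Nat.succ_pos _))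
        (Nat.mul_lt_mul_of_pos_left (hh₂ e he) (Nat.succ_pos _))
    · simp only [hd₁, hd₂]
      ring

theorem potentialCount_insert (src tgt : E → V) {D : Finset E} {e₀ : E} (he₀ : e₀ ∉ D)
    (hne : src e₀ ≠ tgt e₀) :
    potentialCount src tgt (insert e₀ D) = potentialCount src tgt D +
      potentialCount (mergeInto hne ∘ src) (mergeInto hne ∘ tgt) D := by
  unfold potentialCount
  rw [Finset.sum_powerset_insert he₀, ← Finset.sum_add_distrib, ← Finset.sum_add_distrib]
  refine Finset.sum_congr rfl fun σ hσ => ?_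
  rw [Finset.mem_powerset] at hσ
  have hpot : HasPotential src tgt (D : Set E) (σ : Set E) ↔
      (∃ h : V → ℕ, (∀ e ∈ (D : Set E), h (rsrc src tgt σ e) < h (rtgt src tgt σ e)) ∧
        h (src e₀) < h (tgt e₀)) ∨
      (∃ h : V → ℕ, (∀ e ∈ (D : Set E), h (rsrc src tgt σ e) < h (rtgt src tgt σ e)) ∧
        h (tgt e₀) < h (src e₀)) := by
    constructor
    · rintro ⟨h, hh⟩
      rcases lt_trichotomy (h (src e₀)) (h (tgt e₀)) with hlt | heq | hgt
      · exact Or.inl ⟨h, hh, hlt⟩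
      · exact Or.inl ((exists_potential_eq_iff _ _ _ hne).1 ⟨h, hh, heq⟩).1
      · exact Or.inr ⟨h, hh, hgt⟩
    · rintro (⟨h, hh, -⟩ | ⟨h, hh, -⟩) <;> exact ⟨h, hh⟩
  have h1 := hasPotential_insert_iff src tgt he₀ hσ
  have h2 := hasPotential_insert_insert_iff src tgt σ he₀
  have h3 := (hasPotential_merge_iff src tgt (D : Set E) σ hne).trans
    (exists_potential_eq_iff _ _ _ hne)
  simp only [← Finset.mem_coe] at h1 h2
  rw [← h1, ← h2] at h3 hpot
  simp only [h3, hpot]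
  by_cases A : HasPotential src tgt (insert e₀ D : Finset E) σ <;>
  by_cases B : HasPotential src tgt (insert e₀ D : Finset E) (insert e₀ σ : Finset E) <;>
  simp only [A, B] <;> norm_num

theorem potentialCount_eq_zero_of_loop (src tgt : E → V) {D : Finset E} {e₀ : E} (he₀ : e₀ ∈ D)
    (hloop : src e₀ = tgt e₀) : potentialCount src tgt D = 0 := by
  refine Finset.sum_eq_zero fun σ _ => if_neg ?_
  rintro ⟨h, hh⟩
  have := hh e₀ he₀
  simp [rsrc, rtgt, hloop] at this

theorem sum_merge [Fintype V] {K : Type} [Fintype K] {a b : V} (hab : a ≠ b) (f : (V → K) → ℚ) :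
    ∑ x : V → K, (if x a = x b then f x else 0) =
      ∑ y : MergedVertex b → K, f (y ∘ mergeInto hab) := by
  rw [← Finset.sum_filter]
  refine Finset.sum_bij' (fun x _ => fun v => x v.1) (fun y _ => y ∘ mergeInto hab) ?_ ?_ ?_ ?_ ?_
  · simp
  · simp [mergeInto_eq hab]
  · intro x hx
    exact funext fun v => apply_mergeInto hab (by simpa using hx) v
  · intro y _
    exact funext fun v => by simp [mergeInto_val]
  · intro x hx
    congr 1
    exact funext fun v => (apply_mergeInto hab (by simpa using hx) v).symm

/-- The chromatic polynomial of the spanning subgraph with edges `D`, together with its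
reciprocity: up to sign, its value at `-k` counts pairs of a `k`-colouring and an acyclic
reorientation of the monochromatic edges. -/
theorem exists_chromatic_polynomial (D : Finset E) : ∀ {V : Type} [Fintype V] (src tgt : E → V),
    ∃ p : Polynomial ℚ, ∀ (K : Type) [Fintype K],
      p.eval (Fintype.card K : ℚ) =
        ∑ x : V → K, (if ∀ e ∈ D, x (src e) ≠ x (tgt e) then 1 else 0) ∧
      (-1) ^ Fintype.card V * p.eval (-(Fintype.card K : ℚ)) =
        ∑ x : V → K, potentialCount src tgt (D.filter fun e => x (src e) = x (tgt e)) := by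
  induction D using Finset.induction_on with
  | empty =>
    intro V _ src tgt
    refine ⟨Polynomial.X ^ Fintype.card V, fun K _ => ⟨by simp, ?_⟩⟩
    simp [potentialCount, HasPotential, ← mul_pow]
  | insert e₀ D he₀ ih =>
    intro V _ src tgt
    by_cases hne : src e₀ = tgt e₀
    · refine ⟨0, fun K _ => ⟨by simp [hne], ?_⟩⟩
      rw [Finset.sum_eq_zero fun x _ => potentialCount_eq_zero_of_loop src tgt (e₀ := e₀)
        (by simp [hne]) hne]
      simp
    obtain ⟨p, hp⟩ := ih src tgt
    obtain ⟨q, hq⟩ := ih (mergeInto hne ∘ src) (mergeInto hne ∘ tgt)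
    refine ⟨p - q, fun K _ => ?_⟩
    obtain ⟨hp1, hp2⟩ := hp K
    obtain ⟨hq1, hq2⟩ := hq K
    constructor
    · rw [Polynomial.eval_sub, hp1, hq1, sub_eq_iff_eq_add]
      have := sum_merge hne fun x : V → K =>
        if ∀ e ∈ D, x (src e) ≠ x (tgt e) then (1 : ℚ) else 0
      simp only [Function.comp] at this ⊢
      rw [← this, ← Finset.sum_add_distrib]
      refine Finset.sum_congr rfl fun x _ => ?_
      by_cases hx : x (src e₀) = x (tgt e₀) <;> simp [hx]
    · have hcard := card_eq_card_mergedVertex_add_one (tgt e₀)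
      have := sum_merge hne fun x : V → K =>
        potentialCount (mergeInto hne ∘ src) (mergeInto hne ∘ tgt)
          (D.filter fun e => x (src e) = x (tgt e))
      simp only [Function.comp] at this hq2
      have hsplit : ∀ x : V → K,
          potentialCount src tgt ((insert e₀ D).filter fun e => x (src e) = x (tgt e)) =
            potentialCount src tgt (D.filter fun e => x (src e) = x (tgt e)) +
            if x (src e₀) = x (tgt e₀) then
              potentialCount (mergeInto hne ∘ src) (mergeInto hne ∘ tgt)
                (D.filter fun e => x (src e) = x (tgt e)) else 0 := by
        intro x
        rw [Finset.filter_insert]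
        split_ifs with hx
        · exact potentialCount_insert src tgt (by simp [he₀]) hne
        · rw [add_zero]
      simp only [hsplit, Finset.sum_add_distrib, ← hp2]
      simp only [Function.comp_def] at this hq2 ⊢
      rw [this, ← hq2, Polynomial.eval_sub, hcard, pow_succ]
      ring

theorem acyclicReorDel_iff [Finite V] (src tgt : E → V) (D : Set E) (σ : Set E) :
    AcyclicReorDel src tgt Dᶜ σ ↔ HasPotential src tgt D σ := by
  rw [AcyclicReorDel, acyclic_iff_exists_potential]
  refine exists_congr fun h => ?_
  constructor
  · exact fun hh e he => hh ⟨e, fun hn => hn he⟩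
  · exact fun hh e => hh e.1 (not_not.1 e.2)

theorem natCard_acyclicReorDel [Finite V] [Fintype E] (src tgt : E → V) (D : Finset E) :
    (Nat.card {σ : Set E // σ ⊆ D ∧ AcyclicReorDel src tgt (D : Set E)ᶜ σ} : ℚ) =
      potentialCount src tgt D := by
  rw [potentialCount, Finset.sum_boole, Nat.cast_inj, ← Fintype.card_coe,
    ← Nat.card_eq_fintype_card]
  refine (Nat.card_congr (Equiv.subtypeEquiv Fintype.finsetEquivSet fun σ => ?_)).symm
  simp [acyclicReorDel_iff]

/-- The number of nowhere-zero tensions as a sum over all tensions. -/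
theorem nzTensionCount_eq_sum [Fintype E] (src tgt : E → V) (l : ℕ) [NeZero l] :
    (nzTensionCount src tgt l : ℚ) =
      ∑ t : {t : E → ZMod l // IsTension src tgt l t}, if ∀ e, t.1 e ≠ 0 then 1 else 0 := by
  rw [Finset.sum_boole, Nat.cast_inj, ← Fintype.card_subtype, ← Nat.card_eq_fintype_card]
  exact Nat.card_congr (Equiv.subtypeSubtypeEquivSubtypeInter _ fun t : E → ZMod l => ∀ e, t e ≠ 0).symm

/-- The pairs of a tension and an acyclic reorientation off its support, as a sum over all
tensions. -/
theorem natCard_tension_acyclicReorDel [Finite V] [Fintype E] (src tgt : E → V) (l : ℕ)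
    [NeZero l] :
    (Nat.card {p : (E → ZMod l) × Set E //
        IsTension src tgt l p.1 ∧ p.2 ⊆ {e | p.1 e = 0} ∧
        AcyclicReorDel src tgt {e | p.1 e ≠ 0} p.2} : ℚ) =
      ∑ t : {t : E → ZMod l // IsTension src tgt l t},
        potentialCount src tgt (Finset.univ.filter fun e => t.1 e = 0) := by
  have e : {p : (E → ZMod l) × Set E //
        IsTension src tgt l p.1 ∧ p.2 ⊆ {e | p.1 e = 0} ∧
        AcyclicReorDel src tgt {e | p.1 e ≠ 0} p.2} ≃
      Σ t : {t : E → ZMod l // IsTension src tgt l t}, {σ : Set E // σ ⊆ {e | t.1 e = 0} ∧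
        AcyclicReorDel src tgt {e | t.1 e ≠ 0} σ} :=
    { toFun := fun p => ⟨⟨p.1.1, p.2.1⟩, p.1.2, p.2.2⟩
      invFun := fun p => ⟨(p.1.1, p.2.1), p.1.2, p.2.2⟩
      left_inv := fun _ => rfl
      right_inv := fun _ => rfl }
  rw [Nat.card_congr e, Nat.card_sigma, Nat.cast_sum]
  refine Finset.sum_congr rfl fun t _ => ?_
  rw [← natCard_acyclicReorDel]
  have h1 : ((Finset.univ.filter fun e => t.1 e = 0 : Finset E) : Set E) = {e | t.1 e = 0} := by
    simp
  rw [h1]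
  rfl

/-- **Modular tension reciprocity.** For the modular tension polynomial
`P = τ̄_G`, `(-1)^{|V|-c(G)} P(-ℓ)` counts the pairs `(t, σ)` of a
`ZMod ℓ`-tension `t` and an acyclic reorientation `σ` of the deletion
`G∖supp t`. -/
theorem modular_tension_reciprocity {V E : Type} [Fintype V] [Fintype E]
    (src tgt : E → V) (l : ℕ) (hl : 0 < l) (P : Polynomial ℚ)
    (hP : ∀ m : ℕ, 0 < m → P.eval (m : ℚ) = nzTensionCount src tgt m) :
    (-1 : ℚ) ^ ((Fintype.card V : ℤ) - (ncomp src tgt : ℤ)) * P.eval (-(l : ℚ)) =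
      Nat.card {p : (E → ZMod l) × Set E //
        IsTension src tgt l p.1 ∧ p.2 ⊆ {e | p.1 e = 0} ∧
        AcyclicReorDel src tgt {e | p.1 e ≠ 0} p.2} := by
  have : NeZero l := ⟨hl.ne'⟩
  obtain ⟨p, hp⟩ := exists_chromatic_polynomial Finset.univ src tgt
  have hpP : p = Polynomial.X ^ ncomp src tgt * P := by
    refine Polynomial.eq_of_infinite_eval_eq _ _ (Set.Infinite.mono ?_
      (Set.infinite_range_of_injective fun a b : ℕ =>
        fun h : ((a + 1 : ℕ) : ℚ) = ((b + 1 : ℕ) : ℚ) => by simpa using h))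
    rintro _ ⟨n, rfl⟩
    have h1 := (hp (ZMod (n + 1))).1
    have h2 := sum_coboundary (n + 1) src tgt fun t => if ∀ e, t e ≠ 0 then 1 else 0
    rw [← nzTensionCount_eq_sum, ← hP _ n.succ_pos] at h2
    simp only [coboundary, sub_ne_zero] at h2
    rw [ZMod.card] at h1
    show p.eval _ = Polynomial.eval _ _
    rw [Polynomial.eval_mul, Polynomial.eval_pow, Polynomial.eval_X, h1, ← h2]
    simp [ne_comm]
  have h1 := (hp (ZMod l)).2
  have h2 := sum_coboundary l src tgt fun t =>
    potentialCount src tgt (Finset.univ.filter fun e => t e = 0)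
  rw [← natCard_tension_acyclicReorDel] at h2
  have hsymm : ∀ (x : V → ZMod l) (e : E), x (tgt e) = x (src e) ↔ x (src e) = x (tgt e) :=
    fun _ _ => eq_comm
  simp only [coboundary, sub_eq_zero, hsymm] at h2
  rw [ZMod.card] at h1
  replace h1 := h1.trans (Eq.trans (by congr!) h2)
  rw [hpP, Polynomial.eval_mul, Polynomial.eval_pow, Polynomial.eval_X,
    neg_pow] at h1
  have hl0 : (l : ℚ) ^ ncomp src tgt ≠ 0 := pow_ne_zero _ (NeZero.ne _)
  refine mul_left_cancel₀ hl0 (Eq.trans ?_ h1)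
  have hs : ((-1 : ℚ) ^ ncomp src tgt)⁻¹ = (-1) ^ ncomp src tgt := by
    rw [← inv_pow, inv_neg_one]
  rw [zpow_sub₀ (by norm_num), zpow_natCast, zpow_natCast, div_eq_mul_inv, hs]
  ring


end ModularFlows
end

section
/- Let G = (V,E) be an oriented graph and k, ℓ positive integers. Then t_G(1+ℓ, 1+k) = Σ_{S ⊆ T ⊆ E} 2^{|T \ S|} · φ̄_{G[S]}(k) · τ̄_{G_/T}(ℓ), where the sum is over all pairs of edge sets S ⊆ T ⊆ E. -/
namespace ModularFlows

attribute [local instance] Classical.propDecidable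

variable {V E : Type}

open Finset

/-! ### Tensions are potential differences -/

/-- `l` is a walk from `u` to `v` in the underlying undirected graph. -/
def IsWalk (src tgt : E → V) : V → List (E × Bool) → V → Prop
  | u, [], v => u = v
  | u, d :: l, v => uSrc src tgt d = u ∧ IsWalk src tgt (uTgt src tgt d) l v

/-- The value of `t` on an edge traversed forwards or backwards. -/
def signedVal {M : Type*} [Neg M] (t : E → M) (d : E × Bool) : M :=
  if d.2 then t d.1 else -t d.1

theorem isWalk_append {src tgt : E → V} {l₁ l₂ : List (E × Bool)} {u w : V} :
    IsWalk src tgt u (l₁ ++ l₂) w ↔ ∃ v, IsWalk src tgt u l₁ v ∧ IsWalk src tgt v l₂ w := by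
  induction l₁ generalizing u with
  | nil => simp [IsWalk]
  | cons d l ih => simp [IsWalk, ih, and_assoc]

theorem IsWalk.exists_reverse {M : Type*} [AddCommGroup M] {src tgt : E → V} (t : E → M)
    {l : List (E × Bool)} {u v : V} (h : IsWalk src tgt u l v) :
    ∃ l', IsWalk src tgt v l' u ∧ (l'.map (signedVal t)).sum = -(l.map (signedVal t)).sum := by
  induction l generalizing u with
  | nil => exact ⟨[], h.symm, by simp⟩
  | cons d l ih =>
    obtain ⟨l', hl', hs⟩ := ih h.2
    refine ⟨l' ++ [(d.1, !d.2)], isWalk_append.2 ⟨_, hl', ?_⟩, ?_⟩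
    · rcases d with ⟨e, _ | _⟩ <;> simpa [IsWalk, uSrc, uTgt] using h.1
    · rcases d with ⟨e, _ | _⟩ <;> simp [signedVal, hs, add_comm]

theorem exists_split_of_not_nodup_map {α β : Type*} (f : α → β) {l : List α}
    (h : ¬ (l.map f).Nodup) :
    ∃ l₁ a l₂ b l₃, l = l₁ ++ (a :: l₂ ++ b :: l₃) ∧ f a = f b := by
  induction l with
  | nil => simp at h
  | cons a l ih =>
    by_cases ha : f a ∈ l.map f
    · obtain ⟨b, hb, hab⟩ := List.mem_map.1 ha
      obtain ⟨l₂, l₃, rfl⟩ := List.append_of_mem hb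
      exact ⟨[], a, l₂, b, l₃, rfl, hab.symm⟩
    · have : ¬ (l.map f).Nodup := fun h' => h (List.nodup_cons.2 ⟨ha, h'⟩)
      obtain ⟨l₁, a', l₂, b, l₃, rfl, hab⟩ := ih this
      exact ⟨a :: l₁, a', l₂, b, l₃, rfl, hab⟩

theorem IsWalk.uTgt_getElem {src tgt : E → V} {l : List (E × Bool)} {u v : V}
    (h : IsWalk src tgt u l v) (i : ℕ) (hi : i < l.length) :
    uTgt src tgt l[i] = if hi' : i + 1 < l.length then uSrc src tgt l[i + 1] else v := by
  induction l generalizing u i with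
  | nil => simp at hi
  | cons d l ih =>
    cases i with
    | zero =>
      cases l with
      | nil => simpa [IsWalk] using h.2
      | cons d' l => simpa using h.2.1.symm
    | succ i => simpa using ih h.2 i (by simpa using hi)

theorem IsTension.sum_eq_zero_of_nodup {src tgt : E → V} {m : ℕ} {t : E → ZMod m}
    (ht : IsTension src tgt m t) {l : List (E × Bool)} {u : V} (hl : IsWalk src tgt u l u)
    (hnd : (l.map (uSrc src tgt)).Nodup) : (l.map (signedVal t)).sum = 0 := by
  rcases hn : l.length with _ | n
  · simp [List.length_eq_zero_iff.1 hn]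
  have hc : IsUCycle src tgt n (fun i => l[i.1]'(by omega)) := by
    refine ⟨fun i j hij => ?_, fun i => ?_⟩
    · have := (List.nodup_iff_injective_get.1 hnd) (a₁ := ⟨i, by simp; omega⟩)
        (a₂ := ⟨j, by simp; omega⟩) (by simpa using hij)
      simpa [Fin.ext_iff] using this
    · rw [hl.uTgt_getElem]
      split_ifs with hi
      · have : (i + 1).1 = i.1 + 1 := by
          rw [Fin.val_add_one_of_lt]
          rw [Fin.lt_def, Fin.val_last]; omega
        simp [this]
      · have : i = Fin.last n := by ext; rw [Fin.val_last]; omega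
        subst this
        cases l with
        | nil => simp at hn
        | cons d l => simpa using hl.1.symm
  have h0 := ht n _ hc
  rw [← h0]
  have : l.map (signedVal t) = List.ofFn fun i : Fin (n + 1) => signedVal t (l[i.1]'(by omega)) := by
    refine List.ext_getElem (by simp [hn]) fun i h₁ h₂ => ?_
    rw [List.getElem_map, List.getElem_ofFn]
  rw [this, List.sum_ofFn]
  rfl

theorem IsTension.sum_eq_zero {src tgt : E → V} {m : ℕ} {t : E → ZMod m}
    (ht : IsTension src tgt m t) {l : List (E × Bool)} {u : V} (hl : IsWalk src tgt u l u) :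
    (l.map (signedVal t)).sum = 0 := by
  induction hn : l.length using Nat.strong_induction_on generalizing l u with
  | _ n ih =>
    by_cases hnd : (l.map (uSrc src tgt)).Nodup
    · exact ht.sum_eq_zero_of_nodup hl hnd
    obtain ⟨l₁, a, l₂, b, l₃, rfl, hab⟩ := exists_split_of_not_nodup_map _ hnd
    obtain ⟨x, h₁, h₂⟩ := isWalk_append.1 hl
    obtain ⟨y, h₂, h₃⟩ := isWalk_append.1 h₂
    obtain rfl : x = y := by rw [← h₂.1, ← h₃.1, hab]
    have e₁ := ih (a :: l₂).length (by simp [← hn]; omega) h₂ rfl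
    have e₂ := ih (l₁ ++ b :: l₃).length (by simp [← hn])
      (isWalk_append.2 ⟨x, h₁, h₃⟩) rfl
    simp only [List.map_append, List.sum_append] at e₁ e₂ ⊢
    rw [e₁, zero_add, e₂]

theorem isTension_iff_exists_potential {src tgt : E → V} {m : ℕ} {t : E → ZMod m} :
    IsTension src tgt m t ↔ ∃ p : V → ZMod m, ∀ e, t e = p (tgt e) - p (src e) := by
  constructor
  · intro ht
    let s : Setoid V :=
      { r := fun u v => ∃ l, IsWalk src tgt u l v
        iseqv :=
          ⟨fun _ => ⟨[], rfl⟩,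
            fun ⟨_, h⟩ => let ⟨l', h', _⟩ := h.exists_reverse t; ⟨l', h'⟩,
            fun ⟨l₁, h₁⟩ ⟨l₂, h₂⟩ => ⟨l₁ ++ l₂, isWalk_append.2 ⟨_, h₁, h₂⟩⟩⟩ }
    have hroot (v : V) : ∃ l, IsWalk src tgt (Quotient.mk s v).out l v :=
      Quotient.exact (Quotient.out_eq (Quotient.mk s v))
    choose w hw using hroot
    refine ⟨fun v => ((w v).map (signedVal t)).sum, fun e => ?_⟩
    have he : IsWalk src tgt (src e) [(e, true)] (tgt e) := by simp [IsWalk, uSrc, uTgt]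
    have hq : Quotient.mk s (src e) = Quotient.mk s (tgt e) := Quotient.sound ⟨_, he⟩
    obtain ⟨l', hl', hs⟩ := (hw (tgt e)).exists_reverse t
    have h0 := ht.sum_eq_zero (isWalk_append.2 ⟨_, hw (src e), isWalk_append.2 ⟨_, he, hq ▸ hl'⟩⟩)
    simp only [List.map_append, List.sum_append, hs] at h0
    simp only [List.map_cons, List.map_nil, List.sum_singleton, signedVal, if_true] at h0
    linear_combination h0
  · rintro ⟨p, hp⟩ n c ⟨-, hc⟩
    have (i : Fin (n + 1)) : (if (c i).2 then t (c i).1 else -t (c i).1) =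
        p (uSrc src tgt (c (i + 1))) - p (uSrc src tgt (c i)) := by
      rw [← hc i]
      rcases c i with ⟨e, _ | _⟩ <;> simp [uSrc, uTgt, hp]
    simp_rw [this, sum_sub_distrib]
    rw [sub_eq_zero]
    exact Equiv.sum_comp (Equiv.addRight (1 : Fin (n + 1))) fun i => p (uSrc src tgt (c i))

/-! ### Counting potentials and tensions -/

/-- Functions constant along the edges of `S` are functions on the components of `(V, S)`. -/
def constOnEquiv (src tgt : E → V) (S : Set E) (M : Type*) :
    {p : V → M // ∀ e ∈ S, p (tgt e) = p (src e)} ≃ (Quot (linkRel src tgt S) → M) where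
  toFun p := Quot.lift p.1 fun _ _ ⟨e, he, hs, ht⟩ => hs ▸ ht ▸ (p.2 e he).symm
  invFun q := ⟨fun v => q (Quot.mk _ v), fun e he => congrArg q (Quot.sound ⟨e, he, rfl, rfl⟩).symm⟩
  left_inv _ := rfl
  right_inv _ := funext fun x => Quot.inductionOn x fun _ => rfl

theorem card_constOn [Finite V] (src tgt : E → V) (S : Set E) (m : ℕ) :
    Nat.card {p : V → ZMod m // ∀ e ∈ S, p (tgt e) = p (src e)} = m ^ ncompSub src tgt S := by
  rw [Nat.card_congr (constOnEquiv src tgt S (ZMod m)), Nat.card_fun, Nat.card_zmod, ncompSub]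

theorem ncompSub_anti [Finite V] (src tgt : E → V) {S T : Set E} (h : S ⊆ T) :
    ncompSub src tgt T ≤ ncompSub src tgt S :=
  Nat.card_le_card_of_surjective
    (Quot.map id fun _ _ ⟨e, he, h'⟩ => ⟨e, h he, h'⟩)
    (fun x => Quot.inductionOn x fun v => ⟨Quot.mk _ v, rfl⟩)

theorem ncompSub_le_card [Fintype V] (src tgt : E → V) (S : Set E) :
    ncompSub src tgt S ≤ Fintype.card V := by
  rw [← Nat.card_eq_fintype_card]
  exact Nat.card_le_card_of_surjective (Quot.mk _) Quot.mk_surjective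

/-- Potentials whose difference vanishes exactly on `T` correspond to nowhere-zero tensions of
`G/T`, up to potentials that are constant on components. -/
theorem card_potential_eq [Finite V] (src tgt : E → V) (T : Set E) (m : ℕ) :
    Nat.card {p : V → ZMod m // ∀ e, p (tgt e) = p (src e) ↔ e ∈ T} =
      m ^ ncompSub src tgt Set.univ * nzTensionCount (csrc src tgt T) (ctgt src tgt T) m := by
  have key (t : {t : {e : E // e ∉ T} → ZMod m //
      IsTension (csrc src tgt T) (ctgt src tgt T) m t ∧ ∀ e, t e ≠ 0}) :
      ∃ p : V → ZMod m, (∀ e ∈ T, p (tgt e) = p (src e)) ∧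
        ∀ e, t.1 e = p (tgt e) - p (src e) := by
    obtain ⟨q, hq⟩ := isTension_iff_exists_potential.1 t.2.1
    exact ⟨_, ((constOnEquiv src tgt T (ZMod m)).symm q).2, hq⟩
  choose P hPT hP using key
  let D (p : {p : V → ZMod m // ∀ e, p (tgt e) = p (src e) ↔ e ∈ T}) :
      {t : {e : E // e ∉ T} → ZMod m //
        IsTension (csrc src tgt T) (ctgt src tgt T) m t ∧ ∀ e, t e ≠ 0} :=
    ⟨fun e => p.1 (tgt e) - p.1 (src e), isTension_iff_exists_potential.2
      ⟨constOnEquiv src tgt T (ZMod m) ⟨p.1, fun e he => (p.2 e).2 he⟩, fun _ => rfl⟩,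
      fun e => sub_ne_zero.2 fun h => e.2 ((p.2 e).1 h)⟩
  have hadd (h : {p : V → ZMod m // ∀ e ∈ Set.univ, p (tgt e) = p (src e)}) (t) (e : E) :
      (h.1 + P t) (tgt e) = (h.1 + P t) (src e) ↔ e ∈ T := by
    simp only [Pi.add_apply, h.2 e trivial, add_right_inj]
    refine ⟨fun he => ?_, hPT t e⟩
    by_contra heT
    exact t.2.2 ⟨e, heT⟩ (by rw [hP, he, sub_self])
  rw [← card_constOn, nzTensionCount, ← Nat.card_prod]
  refine Nat.card_congr
    { toFun := fun p => ⟨⟨p.1 - P (D p), fun e _ => ?_⟩, D p⟩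
      invFun := fun x => ⟨x.1.1 + P x.2, hadd x.1 x.2⟩
      left_inv := fun p => by simp
      right_inv := fun x => ?_ }
  · by_cases he : e ∈ T
    · simp [(p.2 e).2 he, hPT (D p) e he]
    · have := hP (D p) ⟨e, he⟩
      simp only [D] at this
      simp only [Pi.sub_apply]
      linear_combination this
  · have h2 : D ⟨x.1.1 + P x.2, hadd x.1 x.2⟩ = x.2 := by
      ext e
      simp [D, hP, x.1.2 e.1 trivial]
    ext1
    · ext1
      simp [h2]
    · exact h2

theorem card_eq_sum_card_fiber {α ι : Type*} [Finite α] (s : Finset ι) (f : α → ι) (P : α → Prop)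
    (h : ∀ a, P a ↔ f a ∈ s) :
    Nat.card {a // P a} = ∑ i ∈ s, Nat.card {a // f a = i} := by
  have := Fintype.ofFinite α
  simp only [Nat.card_eq_fintype_card, Fintype.card_subtype]
  rw [card_eq_sum_card_fiberwise (f := f) (t := s) (fun a ha => by simpa [h] using ha)]
  refine sum_congr rfl fun i hi => ?_
  congr 1
  ext a
  simp only [mem_filter, mem_univ, true_and, h]
  exact ⟨fun h => h.2, fun h => ⟨h ▸ hi, h⟩⟩

theorem sum_nzTensionCount [Finite V] [Fintype E] (src tgt : E → V) (S : Finset E) (m : ℕ)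
    (hm : 0 < m) :
    m ^ (ncompSub src tgt ↑S - ncompSub src tgt Set.univ) =
      ∑ T ∈ Icc S univ, nzTensionCount (csrc src tgt ↑T) (ctgt src tgt ↑T) m := by
  have : NeZero m := ⟨hm.ne'⟩
  apply Nat.eq_of_mul_eq_mul_left (pow_pos hm (ncompSub src tgt Set.univ))
  rw [← pow_add, Nat.add_sub_cancel' (ncompSub_anti src tgt (Set.subset_univ _)), mul_sum,
    ← card_constOn, card_eq_sum_card_fiber (Icc S univ)
      (fun p : V → ZMod m => univ.filter fun e => p (tgt e) = p (src e))]
  · refine sum_congr rfl fun T _ => ?_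
    rw [← card_potential_eq]
    simp [Finset.ext_iff]
  · simp [Finset.subset_iff]

/-! ### Counting flows -/

theorem sum_stdAddChar {ι : Type*} [Fintype ι] (k : ℕ) [NeZero k] (a : ι → ZMod k) :
    ∑ x : ι → ZMod k, ZMod.stdAddChar (∑ i, x i * a i) =
      if ∀ i, a i = 0 then (k : ℂ) ^ Fintype.card ι else 0 := by
  have hprod (x : ι → ZMod k) :
      ZMod.stdAddChar (∑ i, x i * a i) = ∏ i, ZMod.stdAddChar (x i * a i) :=
    map_prod (ZMod.stdAddChar (N := k)).toMonoidHom
      (fun i => Multiplicative.ofAdd (x i * a i)) univ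
  simp_rw [hprod]
  rw [← Fintype.prod_sum fun i y => ZMod.stdAddChar (y * a i)]
  simp_rw [AddChar.sum_mulShift _ (ZMod.isPrimitive_stdAddChar k)]
  split_ifs with h
  · simp [h, ZMod.card]
  · push Not at h
    obtain ⟨i, hi⟩ := h
    exact prod_eq_zero (mem_univ i) (by simp [hi])

theorem pairing_eq [Fintype V] [Fintype E] (src tgt : E → V) {k : ℕ} (f : E → ZMod k)
    (p : V → ZMod k) :
    ∑ v, p v * ((∑ e, if tgt e = v then f e else 0) - ∑ e, if src e = v then f e else 0) =
      ∑ e, f e * (p (tgt e) - p (src e)) := by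
  simp_rw [mul_sub, sum_sub_distrib, mul_sum, mul_ite, mul_zero]
  rw [sum_comm, sum_comm (f := fun v e => if src e = v then p v * f e else 0)]
  simp [mul_comm]

theorem card_isFlow [Fintype V] [Fintype E] (src tgt : E → V) (k : ℕ) (hk : 0 < k) :
    k ^ Fintype.card V * Nat.card {f : E → ZMod k // IsFlow src tgt k f} =
      k ^ Fintype.card E * k ^ ncompSub src tgt Set.univ := by
  have : NeZero k := ⟨hk.ne'⟩
  have h1 (f : E → ZMod k) := sum_stdAddChar k
    fun v => (∑ e, if tgt e = v then f e else 0) - ∑ e, if src e = v then f e else 0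
  have h2 (p : V → ZMod k) := sum_stdAddChar k fun e => p (tgt e) - p (src e)
  have h3 := sum_comm (s := univ) (t := univ) (f := fun (f : E → ZMod k) (p : V → ZMod k) =>
    (ZMod.stdAddChar (∑ e, f e * (p (tgt e) - p (src e))) : ℂ))
  simp_rw [pairing_eq] at h1
  simp_rw [h1, h2, sub_eq_zero, ← sum_filter, sum_const, nsmul_eq_mul] at h3
  rw [← card_constOn, Nat.card_eq_fintype_card, Nat.card_eq_fintype_card, Fintype.card_subtype,
    Fintype.card_subtype, mul_comm, mul_comm (k ^ Fintype.card E)]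
  simp only [Set.mem_univ, true_imp_iff]
  simp only [IsFlow, ← sum_filter]
  exact_mod_cast h3

theorem isFlow_restrict_iff [Fintype E] (src tgt : E → V) {k : ℕ} (S : Set E)
    [Fintype {e : E // e ∈ S}] {g : E → ZMod k} (hg : ∀ e ∉ S, g e = 0) :
    IsFlow (ressrc src S) (ressrc tgt S) k (fun e => g e.1) ↔ IsFlow src tgt k g := by
  have hsum (x : E → V) (v : V) :
      (∑ e : {e : E // e ∈ S}, if ressrc x S e = v then g e.1 else 0) =
        ∑ e, if x e = v then g e else 0 := by
    have := sum_subtype (F := ‹_›) (univ.filter (· ∈ S)) (p := (· ∈ S)) (by simp)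
      fun e => if x e = v then g e else 0
    refine this.symm.trans (sum_filter_of_ne fun e _ he => ?_)
    by_contra h
    simp [hg e h] at he
  simp only [IsFlow, hsum]

theorem card_isFlow_restrict [Fintype E] (src tgt : E → V) (k : ℕ) (S : Set E)
    [Fintype {e : E // e ∈ S}] (Q : ({e : E // e ∈ S} → ZMod k) → Prop) :
    Nat.card {f : {e : E // e ∈ S} → ZMod k // IsFlow (ressrc src S) (ressrc tgt S) k f ∧ Q f} =
      Nat.card {g : {f : E → ZMod k // IsFlow src tgt k f} //
        (∀ e ∉ S, g.1 e = 0) ∧ Q fun e => g.1 e.1} := by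
  let ext (f : {e : E // e ∈ S} → ZMod k) (e : E) : ZMod k := if h : e ∈ S then f ⟨e, h⟩ else 0
  have hext (f) : (fun e : {e : E // e ∈ S} => ext f e.1) = f := by
    ext e
    simp [ext, e.2]
  have hext0 (f) (e : E) (he : e ∉ S) : ext f e = 0 := dif_neg he
  refine Nat.card_congr
    { toFun := fun f => ⟨⟨ext f.1, ?_⟩, hext0 f.1, by simpa only [hext] using f.2.2⟩
      invFun := fun g => ⟨fun e => g.1.1 e.1, (isFlow_restrict_iff src tgt S g.2.1).2 g.1.2, g.2.2⟩
      left_inv := fun f => Subtype.ext (hext f.1)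
      right_inv := fun g => ?_ }
  · rw [← isFlow_restrict_iff src tgt S (hext0 f.1), hext]
    exact f.2.1
  · ext e
    by_cases he : e ∈ S
    · simp [ext, he]
    · simp [ext, he, g.2.1 e he]

theorem linkRel_ressrc (src tgt : E → V) (S : Set E) :
    linkRel (ressrc src S) (ressrc tgt S) Set.univ = linkRel src tgt S := by
  ext u v
  simp [linkRel, ressrc, and_left_comm]

theorem sum_nzFlowCount [Fintype V] [Fintype E] (src tgt : E → V) (k : ℕ) (hk : 0 < k)
    (S : Finset E) :
    k ^ (S.card - rk src tgt ↑S) =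
      ∑ A ∈ S.powerset, nzFlowCount (ressrc src ↑A) (ressrc tgt ↑A) k := by
  have : NeZero k := ⟨hk.ne'⟩
  have hfiber : Nat.card {f : {e : E // e ∈ (S : Set E)} → ZMod k //
      IsFlow (ressrc src ↑S) (ressrc tgt ↑S) k f} =
      ∑ A ∈ S.powerset, nzFlowCount (ressrc src ↑A) (ressrc tgt ↑A) k := by
    have h := card_isFlow_restrict src tgt k (S : Set E) fun _ => True
    simp only [and_true] at h
    rw [h, card_eq_sum_card_fiber S.powerset
      (fun g : {f : E → ZMod k // IsFlow src tgt k f} => univ.filter fun e => g.1 e ≠ 0)]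
    · refine sum_congr rfl fun A _ => ?_
      rw [nzFlowCount, card_isFlow_restrict]
      refine Nat.card_congr (Equiv.subtypeEquivRight fun g => ?_)
      simp only [Finset.ext_iff, mem_filter, mem_univ, true_and, mem_coe, Subtype.forall]
      grind
    · intro g
      simp only [mem_powerset, subset_iff, mem_filter, mem_univ, true_and, mem_coe]
      grind
  have hcard := card_isFlow (ressrc src (S : Set E)) (ressrc tgt (S : Set E)) k hk
  rw [← hfiber]
  have hpos : 0 < Nat.card {f : {e : E // e ∈ (S : Set E)} → ZMod k //
      IsFlow (ressrc src ↑S) (ressrc tgt ↑S) k f} := by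
    have : Nonempty {f : {e : E // e ∈ (S : Set E)} → ZMod k //
      IsFlow (ressrc src ↑S) (ressrc tgt ↑S) k f} := ⟨0, fun v => by simp⟩
    exact Nat.card_pos
  have hc : ncompSub (ressrc src (S : Set E)) (ressrc tgt (S : Set E)) Set.univ =
      ncompSub src tgt S := by
    rw [ncompSub, ncompSub, linkRel_ressrc]
  have hS : Fintype.card {e : E // e ∈ (S : Set E)} = S.card := by simp
  rw [hc, hS, ← pow_add] at hcard
  have hle := ncompSub_le_card src tgt (S : Set E)
  apply Nat.eq_of_mul_eq_mul_left (pow_pos hk (Fintype.card V))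
  rw [hcard, ← pow_add]
  obtain rfl | hk1 := Nat.eq_or_lt_of_le (Nat.succ_le_of_lt hk)
  · simp
  · have : Fintype.card V ≤ S.card + ncompSub src tgt S :=
      (Nat.pow_le_pow_iff_right hk1).1 (hcard ▸ Nat.le_mul_of_pos_right _ hpos)
    congr 1
    rw [rk]
    omega

/-- Convolution formula: `t_G(1+ℓ, 1+k) = Σ_{S ⊆ T ⊆ E} 2^{|T∖S|}
φ̄_{G[S]}(k) · τ̄_{G/T}(ℓ)`. -/
theorem tutte_convolution_formula {V E : Type} [Fintype V] [Fintype E]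
    (src tgt : E → V) (k l : ℕ) (hk : 0 < k) (hl : 0 < l) :
    tutte src tgt (1 + (l : ℚ)) (1 + (k : ℚ)) =
      ∑ T : Finset E, ∑ S ∈ T.powerset,
        (2 : ℚ) ^ (T.card - S.card) *
          (nzFlowCount (ressrc src ↑S) (ressrc tgt ↑S) k : ℚ) *
          (nzTensionCount (csrc src tgt ↑T) (ctgt src tgt ↑T) l : ℚ) := by
  have hterm (S : Finset E) :
      (1 + (l : ℚ) - 1) ^ (rk src tgt Set.univ - rk src tgt ↑S) *
          (1 + (k : ℚ) - 1) ^ (S.card - rk src tgt ↑S) =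
        ∑ T ∈ Icc S univ, ∑ A ∈ S.powerset,
          (nzFlowCount (ressrc src ↑A) (ressrc tgt ↑A) k : ℚ) *
            nzTensionCount (csrc src tgt ↑T) (ctgt src tgt ↑T) l := by
    have hr : rk src tgt Set.univ - rk src tgt ↑S =
        ncompSub src tgt ↑S - ncompSub src tgt Set.univ := by
      have h₁ := ncompSub_le_card src tgt (S : Set E)
      have h₂ := ncompSub_le_card src tgt (Set.univ : Set E)
      rw [rk, rk]
      omega
    have hflow := congrArg (Nat.cast (R := ℚ)) (sum_nzFlowCount src tgt k hk S)
    have htens := congrArg (Nat.cast (R := ℚ)) (sum_nzTensionCount src tgt S l hl)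
    push_cast at hflow htens
    rw [add_sub_cancel_left, add_sub_cancel_left, hr, hflow, htens, mul_comm, sum_mul_sum,
      sum_comm]
  rw [tutte, sum_congr rfl fun S _ => hterm S,
    sum_comm' (t' := univ) (s' := fun T => T.powerset) (by simp)]
  refine sum_congr rfl fun T _ => ?_
  rw [sum_comm' (t' := T.powerset) (s' := fun A => Icc A T)
    (by simp only [mem_powerset, mem_Icc]
        exact fun S A => ⟨fun h => ⟨⟨h.2, h.1⟩, h.2.trans h.1⟩, fun h => ⟨h.1.2, h.1.1⟩⟩)]
  refine sum_congr rfl fun A hA => ?_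
  rw [sum_const, card_Icc_finset (mem_powerset.1 hA), nsmul_eq_mul, mul_assoc]
  push_cast
  rfl

end ModularFlows
end
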